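/- arXiv:2504.11831 — 4 statements merged into one kernel-verified Lean document; each statement's English description precedes it below -/
import Mathlib

section
/- Let μlb, μub, l, u, μ, σ, σub be real numbers with l ≤ μlb ≤ μ ≤ μub ≤ u, l < u, and 0 < σ < σub. Then C(μ, σ, u, l) > C(μ, σub, u, l); that is, ((gaussianReal μ σ²) (Set.Icc l u)).toReal > ((gaussianReal μ σub²) (Set.Icc l u)).toReal. -/
open ProbabilityTheory

/-- `C m σ u l` is the probability that a Gaussian with mean `m` and standard
deviation `σ` lies in the interval `[l, u]`. -/
noncomputable def C (m σ u l : ℝ) : ℝ :=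
  ((gaussianReal m (Real.toNNReal σ ^ 2)) (Set.Icc l u)).toReal

open MeasureTheory in
lemma isOpenPosMeasure_gaussianReal (m : ℝ) {v : NNReal} (hv : v ≠ 0) :
    (gaussianReal m v).IsOpenPosMeasure :=
  (gaussianReal_absolutelyContinuous' m hv).isOpenPosMeasure

open MeasureTheory in
lemma measureReal_lt_measureReal_of_isOpen {α : Type*} [TopologicalSpace α] [MeasurableSpace α]
    [OpensMeasurableSpace α] {ν : Measure α} [IsFiniteMeasure ν] [ν.IsOpenPosMeasure]
    {s t U : Set α} (hst : s ⊆ t) (hU : IsOpen U) (hne : U.Nonempty) (hUt : U ⊆ t)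
    (hsU : Disjoint s U) : ν.real s < ν.real t := by
  have hpos : 0 < ν.real U := ENNReal.toReal_pos (hU.measure_ne_zero ν hne) (measure_ne_top ν U)
  calc ν.real s < ν.real s + ν.real U := lt_add_of_pos_right _ hpos
    _ = ν.real (s ∪ U) := (measureReal_union hsU hU.measurableSet).symm
    _ ≤ ν.real t := measureReal_mono (Set.union_subset hst hUt)

open MeasureTheory in
lemma measureReal_Icc_lt_measureReal_Icc {ν : Measure ℝ} [IsFiniteMeasure ν] [ν.IsOpenPosMeasure]
    {a a' b b' : ℝ} (ha : a ≤ a') (hb : b' ≤ b) (hab : a' ≤ b') (h : a < a' ∨ b' < b) :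
    ν.real (Set.Icc a' b') < ν.real (Set.Icc a b) := by
  have hsub : Set.Icc a' b' ⊆ Set.Icc a b := Set.Icc_subset_Icc ha hb
  rcases h with h | h
  · refine measureReal_lt_measureReal_of_isOpen hsub isOpen_Ioo (Set.nonempty_Ioo.2 h)
      (fun x hx ↦ ⟨hx.1.le, by linarith [hx.2]⟩) ?_
    exact Set.disjoint_left.2 fun x hx hx' ↦ hx'.2.not_ge hx.1
  · refine measureReal_lt_measureReal_of_isOpen hsub isOpen_Ioo (Set.nonempty_Ioo.2 h)
      (fun x hx ↦ ⟨by linarith [hx.1], hx.2.le⟩) ?_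
    exact Set.disjoint_left.2 fun x hx hx' ↦ hx'.1.not_ge hx.2

lemma C_eq_standard (m u l : ℝ) {σ : ℝ} (hσ : 0 < σ) :
    C m σ u l = (gaussianReal 0 1).real (Set.Icc ((l - m) / σ) ((u - m) / σ)) := by
  have hmap : gaussianReal m (Real.toNNReal σ ^ 2) =
      ((gaussianReal 0 1).map (σ * ·)).map (· + m) := by
    rw [gaussianReal_map_const_mul, gaussianReal_map_add_const]
    congr 1
    · simp
    · ext
      simp [hσ.le]
  rw [C, hmap, MeasureTheory.Measure.map_apply (by fun_prop) measurableSet_Icc,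
    MeasureTheory.Measure.map_apply (by fun_prop) (measurableSet_Icc.preimage (by fun_prop)),
    MeasureTheory.measureReal_def]
  congr 2
  ext x
  simp only [Set.mem_preimage, Set.mem_Icc, div_le_iff₀ hσ, le_div_iff₀ hσ, sub_le_iff_le_add,
    le_sub_iff_add_le, mul_comm]

theorem gaussian_interval_prob_strict_anti_in_sigma
    (μlb μub l u μ σ σub : ℝ)
    (hl : l ≤ μlb) (hμlb : μlb ≤ μ) (hμub : μ ≤ μub) (hu : μub ≤ u)
    (hlu : l < u) (hσ : 0 < σ) (hσub : σ < σub) :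
    C μ σ u l > C μ σub u l := by
  have hσub0 : 0 < σub := hσ.trans hσub
  have hlμ : l - μ ≤ 0 := by linarith
  have hμu : 0 ≤ u - μ := by linarith
  have := isOpenPosMeasure_gaussianReal 0 (one_ne_zero (α := NNReal))
  rw [C_eq_standard μ u l hσ, C_eq_standard μ u l hσub0]
  refine measureReal_Icc_lt_measureReal_Icc ?_ ?_ ?_ ?_
  · rw [div_le_div_iff₀ hσ hσub0]
    exact mul_le_mul_of_nonpos_left hσub.le hlμ
  · exact div_le_div_of_nonneg_left hμu hσ hσub.le
  · gcongr
  · rcases hlμ.lt_or_eq with h | h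
    · left
      rw [div_lt_div_iff₀ hσ hσub0]
      exact mul_lt_mul_of_neg_left hσub h
    · right
      exact div_lt_div_of_pos_left (by linarith) hσ hσub
end

section
/- Let μlb ≤ μub be real numbers, let μ₀ = (μlb + μub)/2, let ζ ≥ 0, let l = μlb − ζ and u = μub + ζ, and let σ > 0. Then for all d₁, d₂ with 0 ≤ d₁ ≤ d₂ ≤ (μub − μlb)/2, C(μ₀ + d₁, σ, u, l) ≥ C(μ₀ + d₂, σ, u, l); that is, ((gaussianReal (μ₀ + d₁) σ²) (Set.Icc l u)).toReal ≥ ((gaussianReal (μ₀ + d₂) σ²) (Set.Icc l u)).toReal. -/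
open ProbabilityTheory

lemma gaussianPDFReal_le_of_sq_le {v : NNReal} {x y : ℝ} (h : x ^ 2 ≤ y ^ 2) :
    gaussianPDFReal 0 v y ≤ gaussianPDFReal 0 v x := by
  simp only [gaussianPDFReal, sub_zero]
  gcongr

lemma gaussianPDFReal_zero_neg (v : NNReal) (x : ℝ) :
    gaussianPDFReal 0 v (-x) = gaussianPDFReal 0 v x := by
  simp [gaussianPDFReal]

lemma toReal_gaussianReal_Icc (m : ℝ) {v : NNReal} (hv : v ≠ 0) {l u : ℝ} (hlu : l ≤ u) :
    (gaussianReal m v (Set.Icc l u)).toReal = ∫ x in (l - m)..(u - m), gaussianPDFReal 0 v x := by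
  rw [gaussianReal_apply_eq_integral m hv, ENNReal.toReal_ofReal
    (MeasureTheory.integral_nonneg fun x ↦ gaussianPDFReal_nonneg m v x),
    MeasureTheory.integral_Icc_eq_integral_Ioc, ← intervalIntegral.integral_of_le hlu,
    ← intervalIntegral.integral_comp_sub_right (fun x ↦ gaussianPDFReal 0 v x) m]
  simp [gaussianPDFReal]

lemma integral_gaussianPDFReal_shift_le (v : NNReal) {r d₁ d₂ : ℝ}
    (h₁ : 0 ≤ d₁) (h₁₂ : d₁ ≤ d₂) (h₂ : d₂ ≤ r) :
    ∫ x in (-r - d₂)..(r - d₂), gaussianPDFReal 0 v x ≤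
      ∫ x in (-r - d₁)..(r - d₁), gaussianPDFReal 0 v x := by
  have hint (a b : ℝ) :
      IntervalIntegrable (gaussianPDFReal 0 v) MeasureTheory.volume a b :=
    (integrable_gaussianPDFReal 0 v).intervalIntegrable
  have hdiff := intervalIntegral.integral_interval_sub_interval_comm
    (hint (-r - d₁) (r - d₁)) (hint (-r - d₂) (r - d₂)) (hint (-r - d₁) (-r - d₂))
  have hneg : ∫ x in (-r - d₂)..(-r - d₁), gaussianPDFReal 0 v x =
      ∫ x in (r + d₁)..(r + d₂), gaussianPDFReal 0 v x := by
    have h := intervalIntegral.integral_comp_neg (gaussianPDFReal 0 v) (a := r + d₁) (b := r + d₂)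
    simp only [gaussianPDFReal_zero_neg] at h
    rw [h]
    congr 1 <;> ring
  have hshift : ∫ x in (r - d₂)..(r - d₁), gaussianPDFReal 0 v (x + (d₁ + d₂)) =
      ∫ x in (r + d₁)..(r + d₂), gaussianPDFReal 0 v x := by
    rw [intervalIntegral.integral_comp_add_right]
    congr 1 <;> ring
  have hmono : ∫ x in (r - d₂)..(r - d₁), gaussianPDFReal 0 v (x + (d₁ + d₂)) ≤
      ∫ x in (r - d₂)..(r - d₁), gaussianPDFReal 0 v x := by
    refine intervalIntegral.integral_mono_on (by linarith)
      ((integrable_gaussianPDFReal 0 v).comp_add_right _).intervalIntegrable (hint _ _)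
      fun x hx ↦ gaussianPDFReal_le_of_sq_le ?_
    have hx0 : 0 ≤ x := by linarith [hx.1]
    gcongr
    linarith
  rw [intervalIntegral.integral_symm (-r - d₂) (-r - d₁),
    intervalIntegral.integral_symm (r - d₂) (r - d₁)] at hdiff
  linarith

theorem gaussian_interval_prob_anti_away_from_center
    (μlb μub μ₀ ζ l u σ : ℝ)
    (hμ : μlb ≤ μub) (hμ₀ : μ₀ = (μlb + μub) / 2) (hζ : 0 ≤ ζ)
    (hli : l = μlb - ζ) (hui : u = μub + ζ) (hσ : 0 < σ) :
    ∀ d₁ d₂ : ℝ, 0 ≤ d₁ → d₁ ≤ d₂ → d₂ ≤ (μub - μlb) / 2 →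
      C (μ₀ + d₁) σ u l ≥ C (μ₀ + d₂) σ u l := by
  intro d₁ d₂ h₁ h₁₂ h₂
  have hv : Real.toNNReal σ ^ 2 ≠ 0 := pow_ne_zero _ (Real.toNNReal_pos.mpr hσ).ne'
  have hlu : l ≤ u := by linarith
  have hr : d₂ ≤ (u - l) / 2 := by linarith
  have hl (d : ℝ) : l - (μ₀ + d) = -((u - l) / 2) - d := by subst hμ₀ hli hui; ring
  have hu (d : ℝ) : u - (μ₀ + d) = (u - l) / 2 - d := by subst hμ₀ hli hui; ring
  simp only [C, toReal_gaussianReal_Icc _ hv hlu, hl, hu]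
  exact integral_gaussianPDFReal_shift_le _ h₁ h₁₂ hr
end

section
/- Let μlb ≤ μub and 0 < σlb ≤ σub be real numbers and let ζ > 0. Then for every μ with μlb ≤ μ ≤ μub and every σ with σlb ≤ σ ≤ σub, C(μ, σ, μub + ζ, μlb − ζ) ≥ C(μub, σub, μub + ζ, μlb − ζ). Furthermore, C(μlb, σub, μub + ζ, μlb − ζ) = C(μub, σub, μub + ζ, μlb − ζ). Here C(m, σ, u, l) := ((gaussianReal m σ²) (Set.Icc l u)).toReal. -/
open ProbabilityTheory

open MeasureTheory in
lemma C_eq_integral_standard {m σ u l : ℝ} (hσ : 0 < σ) (hlu : l ≤ u) :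
    C m σ u l = ∫ x in ((l - m) / σ)..((u - m) / σ), gaussianPDFReal 0 1 x := by
  have hmap : gaussianReal m (Real.toNNReal σ ^ 2) =
      (gaussianReal 0 1).map (fun x ↦ σ * x + m) := by
    have h : (fun x : ℝ ↦ σ * x + m) = (fun x ↦ x + m) ∘ (fun x ↦ σ * x) := rfl
    rw [h, ← Measure.map_map (by fun_prop) (by fun_prop), gaussianReal_map_const_mul,
      gaussianReal_map_add_const]
    congr 1
    · simp
    · ext
      simp [hσ.le]
  have hpre : (fun x ↦ σ * x + m) ⁻¹' Set.Icc l u = Set.Icc ((l - m) / σ) ((u - m) / σ) := by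
    ext x
    simp only [Set.mem_preimage, Set.mem_Icc, div_le_iff₀ hσ, le_div_iff₀ hσ]
    constructor <;> rintro ⟨h₁, h₂⟩ <;> constructor <;> linarith
  have hle : (l - m) / σ ≤ (u - m) / σ := by gcongr
  rw [C, hmap, Measure.map_apply (by fun_prop) measurableSet_Icc, hpre,
    gaussianReal_apply_eq_integral 0 one_ne_zero,
    ENNReal.toReal_ofReal (integral_nonneg fun x ↦ gaussianPDFReal_nonneg 0 1 x),
    intervalIntegral.integral_of_le hle, integral_Icc_eq_integral_Ioc]

lemma gaussianPDFReal_zero_le_of_le (v : NNReal) {x y : ℝ} (hx : 0 ≤ x) (hxy : x ≤ y) :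
    gaussianPDFReal 0 v y ≤ gaussianPDFReal 0 v x := by
  simp only [gaussianPDFReal, sub_zero]
  gcongr

lemma intervalIntegrable_gaussianPDFReal (μ : ℝ) (v : NNReal) (a b : ℝ) :
    IntervalIntegrable (gaussianPDFReal μ v) MeasureTheory.volume a b :=
  (integrable_gaussianPDFReal μ v).intervalIntegrable

lemma integral_gaussianPDFReal_zero_neg (v : NNReal) (a b : ℝ) :
    ∫ x in (-b)..(-a), gaussianPDFReal 0 v x = ∫ x in a..b, gaussianPDFReal 0 v x := by
  rw [← intervalIntegral.integral_comp_neg]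
  simp only [gaussianPDFReal_zero_neg]

/-- Shifting an interval towards being centred at the mean increases its Gaussian mass. -/
lemma integral_gaussianPDFReal_zero_le_shift (v : NNReal) {a b t : ℝ} (hb : 0 ≤ b) (ht : 0 ≤ t)
    (hbt : b + t ≤ a) :
    ∫ x in (-a)..b, gaussianPDFReal 0 v x ≤
      ∫ x in (-a + t)..(b + t), gaussianPDFReal 0 v x := by
  have hint := intervalIntegrable_gaussianPDFReal 0 v
  have hleft := intervalIntegral.integral_add_adjacent_intervals
    (hint (-a) (-a + t)) (hint (-a + t) b)
  have hright := intervalIntegral.integral_add_adjacent_intervals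
    (hint (-a + t) b) (hint b (b + t))
  have htail : ∫ x in (-a)..(-a + t), gaussianPDFReal 0 v x ≤
      ∫ x in b..(b + t), gaussianPDFReal 0 v x := by
    calc ∫ x in (-a)..(-a + t), gaussianPDFReal 0 v x
        = ∫ x in (a - t)..a, gaussianPDFReal 0 v x := by
          rw [← integral_gaussianPDFReal_zero_neg v (a - t) a]
          congr 1
          ring
      _ = ∫ x in b..(b + t), gaussianPDFReal 0 v (x + (a - t - b)) := by
          rw [intervalIntegral.integral_comp_add_right]
          congr 1 <;> ring
      _ ≤ ∫ x in b..(b + t), gaussianPDFReal 0 v x := by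
          refine intervalIntegral.integral_mono_on (by linarith)
            ((integrable_gaussianPDFReal 0 v).comp_add_right _).intervalIntegrable
            (hint _ _) fun x hx ↦ ?_
          exact gaussianPDFReal_zero_le_of_le v (hb.trans hx.1) (by linarith)
  linarith

lemma C_anti_sd {m σ τ u l : ℝ} (hσ : 0 < σ) (hστ : σ ≤ τ) (hl : l ≤ m) (hu : m ≤ u) :
    C m τ u l ≤ C m σ u l := by
  have hτ := hσ.trans_le hστ
  rw [C_eq_integral_standard hσ (hl.trans hu), C_eq_integral_standard hτ (hl.trans hu)]
  refine intervalIntegral.integral_mono_interval ?_ ?_ ?_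
    (Filter.Eventually.of_forall fun x ↦ gaussianPDFReal_nonneg 0 1 x)
    (intervalIntegrable_gaussianPDFReal 0 1 _ _)
  · rw [div_le_div_iff₀ hσ hτ]
    nlinarith
  · gcongr
    exact hl.trans hu
  · have : 0 ≤ u - m := sub_nonneg.2 hu
    gcongr

theorem support_selection_lemma
    (μlb μub σlb σub ζ : ℝ)
    (hμ : μlb ≤ μub) (hσlb : 0 < σlb) (hσ : σlb ≤ σub) (hζ : 0 < ζ) :
    (∀ μ σ : ℝ, μlb ≤ μ → μ ≤ μub → σlb ≤ σ → σ ≤ σub →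
        C μ σ (μub + ζ) (μlb - ζ) ≥ C μub σub (μub + ζ) (μlb - ζ)) ∧
      C μlb σub (μub + ζ) (μlb - ζ) = C μub σub (μub + ζ) (μlb - ζ) := by
  have hσub : 0 < σub := hσlb.trans_le hσ
  have hlu : μlb - ζ ≤ μub + ζ := by linarith
  refine ⟨fun μ σ h₁ h₂ h₃ h₄ ↦ ?_, ?_⟩
  · refine le_trans ?_ (C_anti_sd (hσlb.trans_le h₃) h₄ (by linarith) (by linarith))
    rw [C_eq_integral_standard hσub hlu, C_eq_integral_standard hσub hlu]
    have ht : 0 ≤ (μub - μ) / σub := div_nonneg (by linarith) hσub.le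
    have hbt : ζ / σub + (μub - μ) / σub ≤ (ζ + (μub - μlb)) / σub := by
      rw [← add_div]
      gcongr
    have hshift := integral_gaussianPDFReal_zero_le_shift 1 (by positivity) ht hbt
    have hl : -((ζ + (μub - μlb)) / σub) = (μlb - ζ - μub) / σub := by ring
    have hu : ζ / σub = (μub + ζ - μub) / σub := by ring
    have hl' : -((ζ + (μub - μlb)) / σub) + (μub - μ) / σub = (μlb - ζ - μ) / σub := by ring
    have hu' : ζ / σub + (μub - μ) / σub = (μub + ζ - μ) / σub := by ring
    rwa [hl', hu', hl, hu] at hshift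
  · rw [C_eq_integral_standard hσub hlu, C_eq_integral_standard hσub hlu,
      ← integral_gaussianPDFReal_zero_neg]
    congr 1 <;> ring
end

section
/- Let μlb ≤ μub and 0 < σlb ≤ σub be real numbers, let δ ∈ (0, 1/2), and let q ∈ ℝ satisfy Φ(q) − Φ((μlb − μub)/σub − q) ≥ 1 − δ, where Φ is the standard normal CDF. Then for every μ with μlb ≤ μ ≤ μub and every σ with σlb ≤ σ ≤ σub, the Gaussian measure gaussianReal μ σ² assigns the interval [μlb − σub·q, μub + σub·q] probability at least 1 − δ; that is, C(μ, σ, μub + σub·q, μlb − σub·q) ≥ 1 − δ. -/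
open ProbabilityTheory

/-- `Φ` is the standard normal cumulative distribution function. -/
noncomputable def Φ (x : ℝ) : ℝ :=
  ((gaussianReal 0 1) (Set.Iic x)).toReal

open MeasureTheory Set

lemma gaussianReal_Icc_standardize (m l u : ℝ) {σ : ℝ} (hσ : 0 < σ) :
    gaussianReal m (Real.toNNReal σ ^ 2) (Icc l u) =
      gaussianReal 0 1 (Icc ((l - m) / σ) ((u - m) / σ)) := by
  have hmap : gaussianReal m (Real.toNNReal σ ^ 2) =
      ((gaussianReal 0 1).map (σ * ·)).map (m + ·) := by
    rw [gaussianReal_map_const_mul, gaussianReal_map_const_add]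
    congr 1
    · ring
    · ext
      simp [hσ.le]
  rw [hmap, Measure.map_apply (by fun_prop) measurableSet_Icc,
    Measure.map_apply (by fun_prop) (measurableSet_Icc.preimage (by fun_prop))]
  congr 1
  ext x
  simp only [mem_preimage, mem_Icc, div_le_iff₀ hσ, le_div_iff₀ hσ]
  constructor <;> rintro ⟨h₁, h₂⟩ <;> constructor <;> linarith

lemma gaussianReal_Icc_add_le {a t : ℝ} (b : ℝ) (ha : 0 ≤ a) (ht : 0 ≤ t) :
    gaussianReal 0 1 (Icc (a + t) (b + t)) ≤ gaussianReal 0 1 (Icc a b) := by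
  have hshift : gaussianReal 0 1 (Icc (a + t) (b + t)) = gaussianReal (-t) 1 (Icc a b) := by
    have hmap := gaussianReal_map_add_const (μ := 0) (v := 1) (-t)
    rw [zero_add] at hmap
    rw [← hmap, Measure.map_apply (by fun_prop) measurableSet_Icc]
    congr 1
    ext x
    simp only [mem_preimage, mem_Icc]
    constructor <;> rintro ⟨h₁, h₂⟩ <;> constructor <;> linarith
  rw [hshift, gaussianReal_apply _ one_ne_zero, gaussianReal_apply _ one_ne_zero]
  refine setLIntegral_mono (measurable_gaussianPDF _ _) fun x hx ↦ ?_
  refine ENNReal.ofReal_le_ofReal ?_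
  have hx0 : 0 ≤ x := ha.trans hx.1
  rw [gaussianPDFReal_def, gaussianPDFReal_def]
  beta_reduce
  gcongr
  linarith

lemma gaussianReal_Icc_neg (m a b : ℝ) (v : NNReal) :
    gaussianReal m v (Icc (-b) (-a)) = gaussianReal (-m) v (Icc a b) := by
  rw [← gaussianReal_map_neg, Measure.map_apply (by fun_prop) measurableSet_Icc]
  congr 1
  ext x
  simp only [mem_preimage, mem_Icc]
  constructor <;> rintro ⟨h₁, h₂⟩ <;> constructor <;> linarith

lemma Φ_le_half_of_nonpos {q : ℝ} (hq : q ≤ 0) : Φ q ≤ 1 / 2 := by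
  have : NullSingletonClass (gaussianReal 0 1) := nullSingletonClass_gaussianReal one_ne_zero
  have hneg : (gaussianReal 0 1).real (Ioi (-q)) = Φ q := by
    have hmap := gaussianReal_map_neg (μ := 0) (v := 1)
    rw [neg_zero] at hmap
    rw [Φ, ← Measure.real, measureReal_congr (Iio_ae_eq_Iic (a := q)).symm]
    conv_rhs => rw [← hmap]
    rw [map_measureReal_apply (by fun_prop) measurableSet_Iio]
    congr 1
    ext x
    simp
  have hdisj : Disjoint (Iic q) (Ioi (-q)) :=
    Set.disjoint_left.2 fun x hx hx' ↦ by
      simp only [mem_Iic, mem_Ioi] at hx hx'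
      linarith
  have hunion := measureReal_union (μ := gaussianReal 0 1) hdisj measurableSet_Ioi
  have hle : (gaussianReal 0 1).real (Iic q ∪ Ioi (-q)) ≤ 1 := measureReal_le_one
  rw [hunion, hneg] at hle
  change Φ q + Φ q ≤ 1 at hle
  linarith

lemma Φ_nonneg (x : ℝ) : 0 ≤ Φ x := ENNReal.toReal_nonneg

lemma Φ_sub_Φ_le_Icc {q s t : ℝ} (hq : 0 ≤ q) (ht : 0 ≤ t) (hts : t ≤ s) :
    Φ q - Φ (-s - q) ≤ (gaussianReal 0 1).real (Icc (-t - q) (s - t + q)) := by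
  have : NullSingletonClass (gaussianReal 0 1) := nullSingletonClass_gaussianReal one_ne_zero
  set γ := gaussianReal 0 1
  have hΦ : Φ q - Φ (-s - q) ≤ γ.real (Icc (-s - q) (-t - q)) + γ.real (Icc (-t - q) q) := by
    have hsub : Iic q ⊆ Iic (-s - q) ∪ (Icc (-s - q) (-t - q) ∪ Icc (-t - q) q) := by
      intro x hx
      simp only [mem_union, mem_Iic, mem_Icc] at hx ⊢
      rcases le_total x (-s - q) with h | h
      · exact Or.inl h
      · rcases le_total x (-t - q) with h' | h'
        · exact Or.inr (Or.inl ⟨h, h'⟩)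
        · exact Or.inr (Or.inr ⟨h', hx⟩)
    have h₁ : γ.real (Iic q) ≤ _ := measureReal_mono hsub
    have h₂ := measureReal_union_le (μ := γ) (Iic (-s - q))
      (Icc (-s - q) (-t - q) ∪ Icc (-t - q) q)
    have h₃ := measureReal_union_le (μ := γ) (Icc (-s - q) (-t - q)) (Icc (-t - q) q)
    change γ.real (Iic q) - γ.real (Iic (-s - q)) ≤ _
    linarith
  have htail : γ.real (Icc (-s - q) (-t - q)) ≤ γ.real (Ioc q (s - t + q)) := by
    rw [measureReal_congr (Ioc_ae_eq_Icc (a := q) (b := s - t + q))]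
    refine ENNReal.toReal_mono (measure_ne_top _ _) ?_
    have hneg := gaussianReal_Icc_neg 0 (q + t) (s - t + q + t) 1
    rw [neg_zero] at hneg
    rw [show -s - q = -(s - t + q + t) by ring, show -t - q = -(q + t) by ring, hneg]
    exact gaussianReal_Icc_add_le _ hq ht
  have hdisj : Disjoint (Icc (-t - q) q) (Ioc q (s - t + q)) :=
    Set.disjoint_left.2 fun x hx hx' ↦ not_lt_of_ge hx.2 hx'.1
  have hunion := measureReal_union (μ := γ) hdisj measurableSet_Ioc
  rw [Icc_union_Ioc_eq_Icc (by linarith) (by linarith)] at hunion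
  linarith

theorem support_selection_theorem
    (μlb μub σlb σub δ q : ℝ)
    (hμ : μlb ≤ μub) (hσlb : 0 < σlb) (hσ : σlb ≤ σub)
    (hδ : δ ∈ Set.Ioo (0 : ℝ) (1/2))
    (hq : Φ q - Φ ((μlb - μub) / σub - q) ≥ 1 - δ) :
    ∀ μ σ : ℝ, μlb ≤ μ → μ ≤ μub → σlb ≤ σ → σ ≤ σub →
      C μ σ (μub + σub * q) (μlb - σub * q) ≥ 1 - δ := by
  intro μ σ hμl hμu hσl hσu
  have hσ0 : 0 < σ := hσlb.trans_le hσl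
  have hσub : 0 < σub := hσ0.trans_le hσu
  have hq0 : 0 < q := by
    by_contra! h
    have := Φ_le_half_of_nonpos h
    have := Φ_nonneg ((μlb - μub) / σub - q)
    linarith [hδ.2]
  have hs : (μlb - μub) / σub = -((μub - μlb) / σub) := by ring
  rw [hs] at hq
  have hmain := Φ_sub_Φ_le_Icc (s := (μub - μlb) / σub) (t := (μ - μlb) / σub) hq0.le
    (div_nonneg (by linarith) hσub.le) (by gcongr)
  rw [C, gaussianReal_Icc_standardize _ _ _ hσ0, ← Measure.real]
  refine (hq.le.trans hmain).trans (measureReal_mono (Icc_subset_Icc ?_ ?_))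
  · calc (μlb - σub * q - μ) / σ = -((μ - μlb + σub * q) / σ) := by ring
      _ ≤ -((μ - μlb + σub * q) / σub) := by
        have : 0 ≤ μ - μlb + σub * q := add_nonneg (by linarith) (by positivity)
        gcongr
      _ = -((μ - μlb) / σub) - q := by
        field_simp
        ring
  · calc (μub - μlb) / σub - (μ - μlb) / σub + q
      _ = (μub - μ + σub * q) / σub := by
        field_simp
        ring
      _ ≤ (μub - μ + σub * q) / σ := by
        have : 0 ≤ μub - μ + σub * q := add_nonneg (by linarith) (by positivity)
        gcongr
      _ = (μub + σub * q - μ) / σ := by ring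
end
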